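/- Suppose each of the triples (X, Rᴬ, Sᴬ) and (X, Rᴮ, Sᴮ) satisfies the MAR condition and the ε-positivity condition. Then the counterfactual score difference is identified: Δᴬᴮ := E[Sᴬ − Sᴮ] = E[ μ0ᴬ(X) − μ0ᴮ(X) ], where μ0•(X) := E[(1−R•)·S• | mX] / E[1−R• | mX] for • ∈ {A, B} is computable from the observed data of each classifier. -/

import Mathlib

open MeasureTheory ProbabilityTheory

/-- If `R` is a.s. conditionally bounded away from `1`, then so is `1 - R` from `0`. -/
theorem ae_condExp_one_sub_ne_zero {Ω : Type*} {m mΩ : MeasurableSpace Ω} (hm : m ≤ mΩ)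
    {P : Measure Ω} [IsFiniteMeasure P] {R : Ω → ℝ} (hR : Integrable R P) {ε : ℝ} (hε : 0 < ε)
    (hpos : ∀ᵐ ω ∂P, (P[R|m]) ω ≤ 1 - ε) :
    ∀ᵐ ω ∂P, (P[fun ω' => 1 - R ω'|m]) ω ≠ 0 := by
  have hsub : P[fun ω => 1 - R ω|m] =ᵐ[P] P[fun _ => (1 : ℝ)|m] - P[R|m] :=
    condExp_sub (integrable_const 1) hR m
  rw [condExp_const hm] at hsub
  filter_upwards [hsub, hpos] with ω h h'
  rw [h, Pi.sub_apply]
  linarith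

/-- Under MAR and positivity, the regression of the observed scores is the conditional
expectation of the potential score. -/
theorem condExp_observed_div_ae_eq_condExp {Ω : Type*} {m mΩ : MeasurableSpace Ω} (hm : m ≤ mΩ)
    {P : Measure Ω} [IsFiniteMeasure P] {R S : Ω → ℝ} (hR : Integrable R P)
    (hMAR : P[fun ω => (1 - R ω) * S ω|m]
      =ᵐ[P] fun ω => (P[fun ω' => 1 - R ω'|m]) ω * (P[S|m]) ω)
    {ε : ℝ} (hε : 0 < ε) (hpos : ∀ᵐ ω ∂P, (P[R|m]) ω ≤ 1 - ε) :
    (fun ω => (P[fun ω' => (1 - R ω') * S ω'|m]) ω / (P[fun ω' => 1 - R ω'|m]) ω)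
      =ᵐ[P] P[S|m] := by
  filter_upwards [hMAR, ae_condExp_one_sub_ne_zero hm hR hε hpos] with ω h h'
  rw [h, mul_div_cancel_left₀ _ h']

theorem integrable_of_eq_zero_or_one {Ω : Type*} {mΩ : MeasurableSpace Ω} {P : Measure Ω}
    [IsFiniteMeasure P] {R : Ω → ℝ} (hR : Measurable R) (h01 : ∀ ω, R ω = 0 ∨ R ω = 1) :
    Integrable R P :=
  Integrable.of_bound hR.aestronglyMeasurable 1 <| .of_forall fun ω => by
    rcases h01 ω with h | h <;> simp [h]

/-- **Identification of the counterfactual score difference (end of Section 2.2).**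
If each of the triples `(X, Rᴬ, Sᴬ)` and `(X, Rᴮ, Sᴮ)` satisfies MAR and ε-positivity,
then `Δᴬᴮ = E[Sᴬ − Sᴮ] = E[μ0ᴬ(X) − μ0ᴮ(X)]`, where
`μ0•(X) = E[(1−R•)·S• | σ(X)] / E[1−R• | σ(X)]`. -/
theorem counterfactual_score_difference_identification
    {Ω 𝒳 : Type*} [MeasurableSpace Ω] [MeasurableSpace 𝒳]
    (P : Measure Ω) [IsProbabilityMeasure P]
    (X : Ω → 𝒳) (hX : Measurable X)
    (RA SA RB SB : Ω → ℝ)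
    (hRA : Measurable RA) (hRB : Measurable RB)
    (hRA01 : ∀ ω, RA ω = 0 ∨ RA ω = 1) (hRB01 : ∀ ω, RB ω = 0 ∨ RB ω = 1)
    (hSAmeas : Measurable SA) (hSBmeas : Measurable SB)
    (hSAint : Integrable SA P) (hSBint : Integrable SB P)
    -- the σ-algebra generated by X
    (mX : MeasurableSpace Ω) (hmX : mX = MeasurableSpace.comap X inferInstance)
    -- MAR condition for each triple (X, R•, S•)
    (hMARA : P[fun ω => (1 - RA ω) * SA ω|mX]
      =ᵐ[P] fun ω => (P[fun ω' => 1 - RA ω'|mX]) ω * (P[SA|mX]) ω)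
    (hMARB : P[fun ω => (1 - RB ω) * SB ω|mX]
      =ᵐ[P] fun ω => (P[fun ω' => 1 - RB ω'|mX]) ω * (P[SB|mX]) ω)
    -- ε-positivity condition for each classifier: π•(X) = E[R• | mX] ≤ 1 − ε a.s.
    (ε : ℝ) (hε : 0 < ε)
    (hposA : ∀ᵐ ω ∂P, (P[RA|mX]) ω ≤ 1 - ε)
    (hposB : ∀ᵐ ω ∂P, (P[RB|mX]) ω ≤ 1 - ε) :
    ∫ ω, (SA ω - SB ω) ∂P
      = ∫ ω, ((P[fun ω' => (1 - RA ω') * SA ω'|mX]) ω / (P[fun ω' => 1 - RA ω'|mX]) ω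
          - (P[fun ω' => (1 - RB ω') * SB ω'|mX]) ω / (P[fun ω' => 1 - RB ω'|mX]) ω) ∂P := by
  have hm := hX.comap_le
  rw [← hmX] at hm
  have hA := condExp_observed_div_ae_eq_condExp hm
    (integrable_of_eq_zero_or_one hRA hRA01) hMARA hε hposA
  have hB := condExp_observed_div_ae_eq_condExp hm
    (integrable_of_eq_zero_or_one hRB hRB01) hMARB hε hposB
  refine Eq.trans ?_ (integral_congr_ae (hA.sub hB)).symm
  rw [integral_sub hSAint hSBint, integral_sub' integrable_condExp integrable_condExp,
    integral_condExp hm, integral_condExp hm]
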